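/- arXiv:2405.17981 — 2 statements merged into one kernel-verified Lean document; each statement's English description precedes it below -/
import Mathlib

section
/- For every rational integer $f>2$, $\frac{2}{\phi(f)}\sum_{\chi\bmod f,\ \chi(-1)=1}\vert L(4,\chi)\vert^2=\frac{\pi^8}{9450}\left(\phi_8(f)+\frac{14}{3}\frac{\phi_4(f)}{f^4}+\frac{200}{3}\frac{\phi_2(f)}{f^6}\right)$, the sum being over the $\phi(f)/2$ even Dirichlet characters modulo $f$. -/
open scoped Classical Real

open HurwitzZeta ZMod ArithmeticFunction in
/-- The discrete Fourier transform of the even Hurwitz zeta values `ζ(4, j / N)`. -/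
theorem dft_hurwitzZetaEven_four (N : ℕ) [NeZero N] (k : ZMod N) :
    𝓕 (fun j : ZMod N ↦ hurwitzZetaEven (toAddCircle j) 4) k =
      N ^ 4 * cosZeta (toAddCircle k) 4 := by
  have hN : (N : ℂ) ≠ 0 := NeZero.ne _
  have h (k : ZMod N) : ∑ j : ZMod N, stdAddChar (k * j) * hurwitzZeta (toAddCircle j) 4 =
      N ^ 4 * expZeta (toAddCircle k) 4 := by
    rw [← LFunction_stdAddChar_eq_expZeta k 4 (by right; norm_num), LFunction, Complex.cpow_neg,
      ← mul_assoc]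
    norm_cast
    rw [mul_inv_cancel₀ (by exact_mod_cast pow_ne_zero 4 hN), one_mul]
  have h2 : ∑ j : ZMod N, stdAddChar (k * j) * hurwitzZeta (toAddCircle j) 4
     = ∑ j : ZMod N, stdAddChar (-k * j) * hurwitzZeta (toAddCircle (-j)) 4 :=
    Fintype.sum_equiv (.neg _) _ _ fun j ↦ by simp
  have h3 : ∑ j : ZMod N, stdAddChar (-k * j) * hurwitzZetaEven (toAddCircle j) 4 =
     (∑ j : ZMod N, stdAddChar (-k * j) * hurwitzZeta (toAddCircle j) 4 +
      ∑ j : ZMod N, stdAddChar (-k * j) * hurwitzZeta (toAddCircle (-j)) 4) / 2 := by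
    rw [← Finset.sum_add_distrib, Finset.sum_div]
    refine Finset.sum_congr rfl fun j _ => ?_
    rw [map_neg, hurwitzZeta, hurwitzZeta, hurwitzZetaEven_neg, hurwitzZetaOdd_neg]
    ring
  rw [dft_apply, cosZeta_eq]
  simp_rw [mul_comm _ k, ← neg_mul, smul_eq_mul]
  rw [h3, ← h2, h, h, map_neg]
  ring

open HurwitzZeta ZMod in
/-- Parseval's identity between even Hurwitz zeta values and cosine zeta values. -/
theorem sum_hurwitzZetaEven_four_sq (N : ℕ) [NeZero N] :
    ∑ j : ZMod N, hurwitzZetaEven (toAddCircle j) 4 ^ 2 =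
      N ^ 7 * ∑ j : ZMod N, cosZeta (toAddCircle j) 4 ^ 2 := by
  have hN : (N : ℂ) ≠ 0 := NeZero.ne _
  set W : ZMod N → ℂ := fun j ↦ hurwitzZetaEven (toAddCircle j) 4 with hW
  set C : ZMod N → ℂ := fun j ↦ cosZeta (toAddCircle j) 4 with hC
  have hWe (j : ZMod N) : W (-j) = W j := by simp only [hW, map_neg, hurwitzZetaEven_neg]
  have hCe (j : ZMod N) : C (-j) = C j := by simp only [hC, map_neg, cosZeta_neg]
  have h1 : 𝓕 W = fun k ↦ (N : ℂ) ^ 4 * C k := funext (dft_hurwitzZetaEven_four N)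
  have h2 (j) : (N : ℂ) ^ 4 * 𝓕 C j = N * W j := by
    have := congrFun (dft_dft W) j
    rw [h1, dft_const_mul, hWe] at this
    simpa using this
  have h3 : ∑ j, (W j * 𝓕 C j) = ∑ j, C j * 𝓕 W j := by
    simp only [dft_apply, Finset.mul_sum, smul_eq_mul]
    rw [Finset.sum_comm]
    exact Finset.sum_congr rfl fun i _ ↦ Finset.sum_congr rfl fun j _ ↦ by rw [mul_comm i j]; ring
  have h4 : (N : ℂ) * ∑ j, W j ^ 2 = N * (N ^ 7 * ∑ j, C j ^ 2) := by
    calc _ = (N : ℂ) ^ 4 * ∑ j, (W j * 𝓕 C j) := by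
          simp_rw [Finset.mul_sum]
          exact Finset.sum_congr rfl fun j _ ↦ by linear_combination - W j * h2 j
      _ = _ := by
          rw [h3, h1]
          simp_rw [Finset.mul_sum]
          exact Finset.sum_congr rfl fun j _ ↦ by ring
  exact mul_left_cancel₀ hN h4

open HurwitzZeta in
theorem cosZeta_four {x : ℝ} (hx : x ∈ Set.Icc 0 1) :
    cosZeta x 4 = ((-(π ^ 4 / 3) * (x ^ 4 - 2 * x ^ 3 + x ^ 2 - 1 / 30) : ℝ) : ℂ) := by
  have := cosZeta_two_mul_nat (k := 2) two_ne_zero hx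
  have hb : bernoulli 4 = -1 / 30 := by
    rw [bernoulli_eq_bernoulli'_of_ne_one (by norm_num), bernoulli'_four]
  have hb3 : bernoulli 3 = 0 := by
    rw [bernoulli_eq_bernoulli'_of_ne_one (by norm_num), bernoulli'_three]
  norm_num at this
  rw [this]
  simp [Polynomial.bernoulli, Finset.sum_range_succ, hb, hb3, bernoulli_two, bernoulli_one, Nat.choose]
  ring

/-- A homogenized Faulhaber formula for the squares of the fourth Bernoulli polynomial. -/
theorem sum_range_bernoulli_four_sq (n : ℕ) (x : ℝ) :
    ∑ k ∈ Finset.range n, ((k:ℝ) ^ 4 - 2 * k ^ 3 * x + k ^ 2 * x ^ 2 - x ^ 4 / 30) ^ 2 =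
   ((n:ℝ)^9/9 - n^8/2+2*n^7/3-7*n^5/15+2*n^3/9-n/30) -
   4 * x * (n^8/8 - n^7/2+7*n^6/12-7*n^4/24+n^2/12)
   + 6 * x^2 * (n^7/7 - n^6/2 + n^5/2 - n^3/6+n/42) - 4 * x^3 * (n^6/6 - n^5/2+5*n^4/12 - n^2/12)
   + (14/15) * x^4 * (n^5/5 - n^4/2 + n^3/3 - n/30)
   + 2/15 * x^5 * (n^4/4 - n^3/2+n^2/4) - x^6/15 * (n^3/3 - n^2/2 + n/6) + n * x^8/900 := by
  induction n with
  | zero => simp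
  | succ n ih => rw [Finset.sum_range_succ, ih]; push_cast; ring

theorem ZMod.sum_val_eq_sum_range {M : Type*} [AddCommMonoid M] (N : ℕ) [NeZero N] (g : ℕ → M) :
    ∑ j : ZMod N, g j.val = ∑ k ∈ Finset.range N, g k := by
  obtain ⟨n, rfl⟩ := Nat.exists_eq_succ_of_ne_zero (NeZero.ne N)
  exact Fin.sum_univ_eq_sum_range g (n + 1)

open HurwitzZeta ZMod in
theorem sum_range_hurwitzZetaEven_four_sq (N : ℕ) [NeZero N] :
    ∑ k ∈ Finset.range N, hurwitzZetaEven ((k / N : ℝ) : UnitAddCircle) 4 ^ 2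
    = ((π ^ 8 / 18900 * ((N : ℝ)^8 + 14 / 3 * N ^ 4 + 200 / 3 * N ^ 2 - 70) : ℝ) : ℂ) := by
  have hN : (N : ℝ) ≠ 0 := NeZero.ne _
  have h := sum_hurwitzZetaEven_four_sq N
  simp only [toAddCircle_apply] at h
  rw [ZMod.sum_val_eq_sum_range N (fun k ↦ hurwitzZetaEven ((k / N : ℝ) : UnitAddCircle) 4 ^ 2),
    ZMod.sum_val_eq_sum_range N (fun k ↦ cosZeta ((k / N : ℝ) : UnitAddCircle) 4 ^ 2)] at h
  rw [h]
  have h2 (k) (hk : k ∈ Finset.range N) : cosZeta ((k / N : ℝ) : UnitAddCircle) 4 ^ 2 =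
    ((π ^ 8 / 9 / (N : ℝ) ^ 8 * ((k:ℝ) ^ 4 - 2 * k ^ 3 * N + k ^ 2 * N ^ 2 - N ^ 4 / 30) ^ 2 : ℝ) : ℂ) := by
    rw [cosZeta_four ⟨by positivity,
      div_le_one_of_le₀ (by exact_mod_cast (Finset.mem_range.mp hk).le) (by positivity)⟩,
      ← Complex.ofReal_pow]
    congr 1
    field_simp
    ring
  rw [Finset.sum_congr rfl h2, ← Complex.ofReal_sum, ← Finset.mul_sum, sum_range_bernoulli_four_sq]
  norm_cast
  push_cast
  field_simp
  ring

open HurwitzZeta in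
theorem conj_hurwitzZetaEven_four (a : UnitAddCircle) :
    (starRingEnd ℂ) (hurwitzZetaEven a 4) = hurwitzZetaEven a 4 := by
  obtain ⟨x, rfl⟩ := QuotientAddGroup.mk_surjective a
  have h := hasSum_int_hurwitzZetaEven x (s := 4) (by norm_num)
  have h' : HasSum (fun n : ℤ ↦ (starRingEnd ℂ) (1 / (↑|n + x| : ℂ) ^ (4 : ℂ) / 2))
      (hurwitzZetaEven x 4) := by
    refine h.congr_fun fun n ↦ ?_
    simp only [Complex.cpow_ofNat, map_div₀, map_one, map_pow, Complex.conj_ofReal, map_ofNat]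
  exact (Complex.hasSum_conj.mp h').unique h |>.symm ▸ rfl

open ArithmeticFunction in
theorem sum_divisors_moebius {R : Type*} [CommRing R] (n : ℕ) :
    (∑ d ∈ n.divisors, ((moebius d : ℤ) : R)) = if n = 1 then 1 else 0 := by
  have := congrArg (fun g : ArithmeticFunction R ↦ g n) (coe_moebius_mul_coe_zeta (R := R))
  rw [coe_mul_zeta_apply, one_apply] at this
  simpa using this

open ArithmeticFunction in
/-- Sums over reduced fractions with denominator `f`, by Möbius inversion. -/
theorem sum_range_coprime_div {R : Type*} [CommRing R] (f : ℕ) (hf : f ≠ 0) (g : ℝ → R) :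
    ∑ k ∈ Finset.range f with k.Coprime f, g (k / f) =
   ∑ d ∈ f.divisors, ((moebius d : ℤ) : R) * ∑ k ∈ Finset.range (f / d), g (k / (f / d : ℕ)) := by
  have h1 (k : ℕ) : (if k.Coprime f then g (k / f) else 0) =
      ∑ d ∈ f.divisors, if d ∣ k then ((moebius d : ℤ) : R) * g (k / f) else 0 := by
    rw [← Finset.sum_filter, ← Finset.sum_mul]
    have : f.divisors.filter (· ∣ k) = (k.gcd f).divisors := by
      ext d; simp [Nat.dvd_gcd_iff, hf, and_comm]
    rw [this, sum_divisors_moebius]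
    simp [Nat.Coprime]
  rw [Finset.sum_filter, Finset.sum_congr rfl fun k _ ↦ h1 k, Finset.sum_comm]
  refine Finset.sum_congr rfl fun d hd ↦ ?_
  obtain ⟨e, rfl⟩ := (Nat.mem_divisors.mp hd).1
  have hd0 : 0 < d := Nat.pos_of_mem_divisors hd
  rw [← Finset.sum_filter, ← Finset.mul_sum, Nat.mul_div_cancel_left _ hd0]
  congr 1
  symm
  refine Finset.sum_bij (fun k _ ↦ d * k) ?_ ?_ ?_ ?_
  · intro k hk
    simp at hk ⊢
    exact Nat.mul_lt_mul_of_pos_left hk hd0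
  · intro a _ b _ hab
    exact Nat.eq_of_mul_eq_mul_left hd0 hab
  · intro b hb
    simp at hb
    obtain ⟨hb, c, rfl⟩ := hb
    exact ⟨c, by simpa using Nat.lt_of_mul_lt_mul_left hb, rfl⟩
  · intro k _
    congr 1
    push_cast
    rw [mul_div_mul_left]
    exact_mod_cast hd0.ne'

open ArithmeticFunction in
/-- The Jordan totient as a divisor sum and as an Euler product. -/
theorem sum_divisors_moebius_mul_pow (k n : ℕ) (hn : n ≠ 0) :
    ∑ d ∈ n.divisors, ((moebius d : ℤ) : ℝ) * ((n / d : ℕ) : ℝ) ^ k =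
      (n : ℝ) ^ k * ∏ p ∈ n.primeFactors, (1 - 1 / (p : ℝ) ^ k) := by
  let g : ArithmeticFunction ℝ := ⟨fun m ↦ if m = 0 then 0 else 1 / (m : ℝ) ^ k, by simp⟩
  have hg : g.IsMultiplicative := by
    refine IsMultiplicative.iff_ne_zero.mpr ⟨by simp [g], fun {a b} ha hb _ ↦ ?_⟩
    simp [g, ha, hb, mul_pow, mul_comm]
  have hp (p) (h : p ∈ n.primeFactors) : p.Prime := Nat.prime_of_mem_primeFactors h
  set r := ∏ p ∈ n.primeFactors, p with hr
  have hr0 : r ≠ 0 := Finset.prod_ne_zero_iff.mpr fun p h ↦ (hp p h).ne_zero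
  have hrs : Squarefree r := Finset.squarefree_prod_of_pairwise_isCoprime
    (fun p h q h' hpq ↦
      Nat.coprime_iff_isRelPrime.mp ((Nat.coprime_primes (hp p h) (hp q h')).mpr hpq))
    fun p h ↦ (hp p h).squarefree
  have key := hg.prodPrimeFactors_one_sub_of_squarefree g hrs
  rw [Nat.primeFactors_prod hp] at key
  have e1 : ∏ p ∈ n.primeFactors, (1 - 1 / (p : ℝ) ^ k) = ∏ p ∈ n.primeFactors, (1 - g p) :=
    Finset.prod_congr rfl fun p h ↦ by simp [g, (hp p h).ne_zero]
  have hrn : r ∣ n := Nat.prod_primeFactors_dvd n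
  rw [e1, key, Finset.mul_sum]
  symm
  refine Finset.sum_subset_zero_on_sdiff (Nat.divisors_subset_of_dvd hn hrn) ?_ ?_
  · intro d hd
    simp only [Finset.mem_sdiff, Nat.mem_divisors] at hd
    rw [moebius_eq_zero_of_not_squarefree]
    · simp
    · intro hs
      refine hd.2 ⟨?_, hr0⟩
      rw [← Nat.prod_primeFactors_of_squarefree hs]
      exact Finset.prod_dvd_prod_of_subset _ _ _ (Nat.primeFactors_mono hd.1.1 hn)
  · intro d hd
    have hd0 : d ≠ 0 := (Nat.pos_of_mem_divisors hd).ne'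
    rw [Nat.cast_div ((Nat.mem_divisors.mp hd).1.trans hrn) (by exact_mod_cast hd0)]
    simp [g, hd0]
    ring

theorem DirichletCharacter.conj_apply_of_isUnit {f : ℕ} [NeZero f] (χ : DirichletCharacter ℂ f)
    {a : ZMod f} (ha : IsUnit a) : (starRingEnd ℂ) (χ a) = χ a⁻¹ := by
  obtain ⟨u, rfl⟩ := ha
  have h := MulChar.star_apply' χ (u : ZMod f)
  rw [MulChar.inv_apply, Ring.inverse_unit, ← ZMod.inv_coe_unit] at h
  exact h

/-- Plancherel's identity for the characters of `(ZMod f)ˣ`. -/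
theorem DirichletCharacter.sum_mul_conj_sum {f : ℕ} [NeZero f] (W : ZMod f → ℂ) :
    ∑ χ : DirichletCharacter ℂ f, (∑ a, χ a * W a) * (starRingEnd ℂ) (∑ a, χ a * W a)
      = (f.totient : ℂ) * ∑ a with IsUnit a, W a * (starRingEnd ℂ) (W a) := by
  have h (χ : DirichletCharacter ℂ f) :
      (∑ a, χ a * W a) * (starRingEnd ℂ) (∑ a, χ a * W a) =
        ∑ a with IsUnit a, ∑ b, (χ a⁻¹ * χ b) * (W b * (starRingEnd ℂ) (W a)) := by
    have h0 : ∑ a, χ a * W a = ∑ a with IsUnit a, χ a * W a := by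
      symm
      rw [Finset.sum_filter]
      refine Finset.sum_congr rfl fun a _ ↦ ?_
      split_ifs with ha
      · rfl
      · rw [χ.map_nonunit ha, zero_mul]
    conv_lhs => rw [mul_comm]; arg 1; rw [h0]
    rw [map_sum, Finset.sum_mul_sum]
    refine Finset.sum_congr rfl fun a ha ↦ Finset.sum_congr rfl fun b _ ↦ ?_
    rw [map_mul, χ.conj_apply_of_isUnit (Finset.mem_filter.mp ha).2]
    ring
  simp_rw [h]
  rw [Finset.sum_comm, Finset.mul_sum]
  refine Finset.sum_congr rfl fun a ha ↦ ?_
  rw [Finset.sum_comm]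
  simp_rw [← Finset.sum_mul,
    DirichletCharacter.sum_char_inv_mul_char_eq ℂ (Finset.mem_filter.mp ha).2]
  simp

open HurwitzZeta ZMod in
theorem DirichletCharacter.sum_even_norm_LFunction_four_sq (f : ℕ) [NeZero f] :
    ((∑ χ ∈ Finset.univ.filter (fun χ : DirichletCharacter ℂ f ↦ χ (-1) = 1),
        ‖χ.LFunction 4‖ ^ 2 : ℝ) : ℂ)
      = f.totient / (f : ℂ) ^ 8 *
        ∑ a : ZMod f with IsUnit a, hurwitzZetaEven (toAddCircle a) 4 ^ 2 := by
  set W : ZMod f → ℂ := fun a ↦ hurwitzZetaEven (toAddCircle a) 4 with hW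
  have hWe : W.Even := fun a ↦ by simp only [hW, map_neg, hurwitzZetaEven_neg]
  have h := DirichletCharacter.sum_mul_conj_sum W
  simp only [hW, conj_hurwitzZetaEven_four, ← sq] at h
  rw [div_mul_eq_mul_div, ← h, Finset.sum_div, Finset.sum_filter]
  push_cast
  refine Finset.sum_congr rfl fun χ _ ↦ ?_
  split_ifs with hχ
  · have hχ' : χ.Even := hχ
    rw [DirichletCharacter.LFunction, ZMod.LFunction_def_even hχ'.to_fun, Complex.mul_conj,
      Complex.normSq_eq_norm_sq, norm_mul, mul_pow, Complex.cpow_neg, Complex.cpow_ofNat]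
    push_cast
    rw [norm_inv, norm_pow, Complex.norm_natCast]
    push_cast
    ring
  · have hodd : χ.Odd := χ.even_or_odd.resolve_left hχ
    have h0 : ∑ a, χ a * W a = 0 := (hodd.to_fun.mul_even hWe).sum_eq_zero
    simp only [hW] at h0
    simp [h0]

open HurwitzZeta ZMod ArithmeticFunction in
theorem sum_isUnit_hurwitzZetaEven_four_sq (f : ℕ) [NeZero f] (hf : f ≠ 1) :
    ∑ a : ZMod f with IsUnit a, hurwitzZetaEven (toAddCircle a) 4 ^ 2 =
      ((π ^ 8 / 18900 * ((f : ℝ) ^ 8 * ∏ p ∈ f.primeFactors, (1 - 1 / (p : ℝ) ^ 8)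
        + 14 / 3 * ((f : ℝ) ^ 4 * ∏ p ∈ f.primeFactors, (1 - 1 / (p : ℝ) ^ 4))
        + 200 / 3 * ((f : ℝ) ^ 2 * ∏ p ∈ f.primeFactors, (1 - 1 / (p : ℝ) ^ 2))) : ℝ) : ℂ) := by
  have hf0 : f ≠ 0 := NeZero.ne f
  have h1 : ∑ a : ZMod f with IsUnit a, hurwitzZetaEven (toAddCircle a) 4 ^ 2 =
      ∑ k ∈ Finset.range f with k.Coprime f, hurwitzZetaEven ((k / f : ℝ) : UnitAddCircle) 4 ^ 2 := by
    rw [Finset.sum_filter, Finset.sum_filter, ← ZMod.sum_val_eq_sum_range]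
    refine Finset.sum_congr rfl fun a _ ↦ ?_
    simp only [← ZMod.isUnit_iff_coprime, ZMod.natCast_zmod_val, toAddCircle_apply]
  rw [h1, sum_range_coprime_div f hf0 fun x ↦ hurwitzZetaEven (x : UnitAddCircle) 4 ^ 2]
  have h2 (d) (hd : d ∈ f.divisors) : ((moebius d : ℤ) : ℂ) * ∑ k ∈ Finset.range (f / d),
      hurwitzZetaEven ((k / (f / d : ℕ) : ℝ) : UnitAddCircle) 4 ^ 2 =
      ((((moebius d : ℤ) : ℝ) * (π ^ 8 / 18900 * (((f / d : ℕ) : ℝ) ^ 8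
        + 14 / 3 * ((f / d : ℕ) : ℝ) ^ 4 + 200 / 3 * ((f / d : ℕ) : ℝ) ^ 2 - 70)) : ℝ) : ℂ) := by
    have : NeZero (f / d) := ⟨(Nat.div_pos (Nat.divisor_le hd) (Nat.pos_of_mem_divisors hd)).ne'⟩
    rw [sum_range_hurwitzZetaEven_four_sq]
    push_cast
    rfl
  rw [Finset.sum_congr rfl h2, ← Complex.ofReal_sum]
  congr 1
  have h0 := sum_divisors_moebius (R := ℝ) f
  rw [if_neg hf] at h0
  rw [← sum_divisors_moebius_mul_pow 8 f hf0, ← sum_divisors_moebius_mul_pow 4 f hf0,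
    ← sum_divisors_moebius_mul_pow 2 f hf0, ← sub_zero (_ + _ + _), ← mul_zero (70 : ℝ), ← h0]
  simp_rw [Finset.mul_sum, ← Finset.sum_add_distrib, ← Finset.sum_sub_distrib, Finset.mul_sum]
  exact Finset.sum_congr rfl fun d _ ↦ by ring

/-- Mean value of `|L(4,χ)|²` over Dirichlet characters mod `f` with `χ(-1) = 1`. -/
theorem mean_value_L_four_sq (f : ℕ) [NeZero f] (hf : 2 < f) :
    (2 / (Nat.totient f : ℝ)) *
      ∑ χ ∈ Finset.univ.filter (fun χ : DirichletCharacter ℂ f => χ (-1) = 1),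
        ‖χ.LFunction 4‖ ^ 2
    = (π ^ 8 / 9450) * ((∏ p ∈ f.primeFactors, (1 - 1 / (p : ℝ) ^ 8)) + (14 / 3) * (∏ p ∈ f.primeFactors, (1 - 1 / (p : ℝ) ^ 4)) / (f : ℝ) ^ 4 + (200 / 3) * (∏ p ∈ f.primeFactors, (1 - 1 / (p : ℝ) ^ 2)) / (f : ℝ) ^ 6) := by
  have h := DirichletCharacter.sum_even_norm_LFunction_four_sq f
  rw [sum_isUnit_hurwitzZetaEven_four_sq f (by lia), ← Complex.ofReal_natCast f,
    ← Complex.ofReal_natCast f.totient, ← Complex.ofReal_pow, ← Complex.ofReal_div,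
    ← Complex.ofReal_mul] at h
  have hf0 : (f : ℝ) ≠ 0 := NeZero.ne _
  have ht : (f.totient : ℝ) ≠ 0 := by
    exact_mod_cast (Nat.totient_pos.mpr (by lia)).ne'
  rw [Complex.ofReal_injective h]
  field_simp
  ring
end

section
/- Let $m\ge 2$ and $d\ge 2$ be rational integers. Then $$\sum_{k=1}^{d-1}\left(\cot^{(m-1)}(\pi k/d)\right)^2=2^{2m}\left((-1)^{m-1}\frac{B_{2m}}{m^2\binom{2m}{m}}d^{2m}+\sum_{k=0}^{\lfloor m/2\rfloor}\frac{B_{2k}B_{2(m-k)}}{m(m-k)}\binom{m}{2k}d^{2k}-\frac{1+(-1)^m}{2}\cdot\frac{B_m^2}{m^2}\right).$$ -/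
open scoped Classical Real

theorem sum_range_succ_eq_of_odd_eq_zero {M : Type*} [AddCommMonoid M] {f : ℕ → M}
    (hf : ∀ i, Odd i → 1 < i → f i = 0) {m : ℕ} (hm : 1 ≤ m) :
    ∑ i ∈ Finset.range (m + 1), f i = f 1 + ∑ k ∈ Finset.range (m / 2 + 1), f (2 * k) := by
  induction m, hm using Nat.le_induction with
  | base => simp [Finset.sum_range_succ, add_comm]
  | succ m hm ih =>
    rw [Finset.sum_range_succ, ih]
    rcases Nat.even_or_odd (m + 1) with h | h
    · obtain ⟨r, hr⟩ := h
      rw [show (m + 1) / 2 + 1 = m / 2 + 1 + 1 by omega, Finset.sum_range_succ _ (m / 2 + 1),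
        show 2 * (m / 2 + 1) = m + 1 by omega, add_assoc]
    · rw [hf _ h (by omega), add_zero]
      obtain ⟨r, hr⟩ := h
      rw [show (m + 1) / 2 = m / 2 by omega]

theorem bernoulli_eval_eq_sum_even {m : ℕ} (hm : 1 ≤ m) (x : ℚ) :
    (Polynomial.bernoulli m).eval x = -(m : ℚ) / 2 * x ^ (m - 1) +
      ∑ k ∈ Finset.range (m / 2 + 1), bernoulli (2 * k) * m.choose (2 * k) * x ^ (m - 2 * k) := by
  have h : (Polynomial.bernoulli m).eval x =
      ∑ i ∈ Finset.range (m + 1), bernoulli i * m.choose i * x ^ (m - i) := by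
    simp [Polynomial.bernoulli, Polynomial.eval_finsetSum]
  rw [h, sum_range_succ_eq_of_odd_eq_zero _ hm]
  · simp only [bernoulli_one, Nat.choose_one_right]
    ring
  · intro i hi h1
    simp [bernoulli_eq_zero_of_odd hi h1]

theorem polynomial_eq_C_of_eval_one_add {P : Polynomial ℚ}
    (h : ∀ x, P.eval (1 + x) = P.eval x) : P = Polynomial.C (P.eval 0) := by
  have hn : ∀ n : ℕ, P.eval (n : ℚ) = P.eval 0 := by
    intro n
    induction n with
    | zero => simp
    | succ n ih => rw [← ih, ← h n]; push_cast; ring_nf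
  refine Polynomial.eq_of_infinite_eval_eq _ _
    ((Set.infinite_range_of_injective (Nat.cast_injective (R := ℚ))).mono ?_)
  rintro _ ⟨n, rfl⟩
  simp [hn]

theorem exists_bernoulli_sq_eq_add_C {m : ℕ} (hm : 1 ≤ m) :
    ∃ c : ℚ, Polynomial.bernoulli m ^ 2 =
      ∑ k ∈ Finset.range (m / 2 + 1),
        Polynomial.C (m * m.choose (2 * k) * bernoulli (2 * k) / (m - k : ℕ)) *
          Polynomial.bernoulli (2 * (m - k)) + Polynomial.C c := by
  set S := ∑ k ∈ Finset.range (m / 2 + 1),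
        Polynomial.C (m * m.choose (2 * k) * bernoulli (2 * k) / (m - k : ℕ)) *
          Polynomial.bernoulli (2 * (m - k)) with hS
  suffices h : ∀ x, (Polynomial.bernoulli m ^ 2 - S).eval (1 + x) =
      (Polynomial.bernoulli m ^ 2 - S).eval x from
    ⟨_, sub_eq_iff_eq_add'.mp (polynomial_eq_C_of_eval_one_add h)⟩
  intro x
  have key : S.eval (1 + x) - S.eval x = 2 * m * x ^ (m - 1) *
      ((Polynomial.bernoulli m).eval x + m / 2 * x ^ (m - 1)) := by
    rw [bernoulli_eval_eq_sum_even hm, hS, Polynomial.eval_finsetSum, Polynomial.eval_finsetSum,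
      ← Finset.sum_sub_distrib]
    rw [show ∀ s : ℚ, -(m : ℚ) / 2 * x ^ (m - 1) + s + m / 2 * x ^ (m - 1) = s by intro s; ring,
      Finset.mul_sum]
    refine Finset.sum_congr rfl fun k hk => ?_
    have hk' : 2 * k ≤ m := by rw [Finset.mem_range] at hk; omega
    have h0 : ((m - k : ℕ) : ℚ) ≠ 0 := by rw [Nat.cast_ne_zero]; omega
    have hp : x ^ (2 * (m - k) - 1) = x ^ (m - 1) * x ^ (m - 2 * k) := by
      rw [← pow_add]; congr 1; omega
    simp only [Polynomial.eval_mul, Polynomial.eval_C, Polynomial.bernoulli_eval_one_add, hp]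
    push_cast
    field_simp
    ring
  simp only [Polynomial.eval_sub, Polynomial.eval_pow, Polynomial.bernoulli_eval_one_add]
  linear_combination -key

theorem bernoulliFun_sq_eq_add {m : ℕ} (hm : 1 ≤ m) :
    ∃ c : ℝ, ∀ x, bernoulliFun m x ^ 2 =
      ∑ k ∈ Finset.range (m / 2 + 1),
        (m * m.choose (2 * k) * bernoulli (2 * k) / (m - k : ℕ) : ℝ) *
          bernoulliFun (2 * (m - k)) x + c := by
  obtain ⟨c, hc⟩ := exists_bernoulli_sq_eq_add_C hm
  refine ⟨c, fun x => ?_⟩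
  have := congrArg (Polynomial.aeval x) hc
  simpa [bernoulliFun, map_sum, Polynomial.eval_map_algebraMap] using this

theorem integral_bernoulliFun_mul_bernoulliFun (m n : ℕ) (hm : 1 ≤ m) :
    ∫ x in (0 : ℝ)..1, bernoulliFun m x * bernoulliFun (n + 1) x =
      (-1) ^ n * (bernoulli (m + n + 1) : ℝ) / (m + n + 1).choose m := by
  have parts (m n : ℕ) :
      ∫ x in (0 : ℝ)..1, bernoulliFun (n + 1) x * bernoulliFun m x =
        bernoulliFun (n + 1) 1 * (bernoulliFun (m + 1) 1 / (m + 1)) -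
          bernoulliFun (n + 1) 0 * (bernoulliFun (m + 1) 0 / (m + 1)) -
        (n + 1) / (m + 1) * ∫ x in (0 : ℝ)..1, bernoulliFun n x * bernoulliFun (m + 1) x := by
    rw [intervalIntegral.integral_mul_deriv_eq_deriv_mul
      (fun x _ => hasDerivAt_bernoulliFun (n + 1) x) (fun x _ => antideriv_bernoulliFun m x)
      (Continuous.intervalIntegrable (by fun_prop) _ _)
      (Continuous.intervalIntegrable (by fun_prop) _ _), ← intervalIntegral.integral_const_mul]
    congr 2
    ext x
    push_cast [Nat.add_sub_cancel]
    ring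
  induction n generalizing m with
  | zero =>
    simp_rw [mul_comm (bernoulliFun m _)]
    have h1 : m + 1 ≠ 1 := by omega
    rw [parts]
    simp only [bernoulliFun_zero, one_mul, integral_bernoulliFun, h1, bernoulliFun_eval_one,
      bernoulliFun_eval_zero, zero_add]
    simp
    ring
  | succ n ih =>
    simp_rw [mul_comm (bernoulliFun m _)]
    rw [parts]
    simp_rw [mul_comm (bernoulliFun (n + 1) _)]
    rw [ih (m + 1) (by omega)]
    have h1 : m + 1 ≠ 1 := by omega
    have h2 : n + 1 + 1 ≠ 1 := by omega
    rw [bernoulliFun_endpoints_eq_of_ne_one h1, bernoulliFun_endpoints_eq_of_ne_one h2,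
      show m + 1 + n + 1 = m + (n + 1) + 1 by ring]
    have hc := Nat.choose_succ_right_eq (m + (n + 1) + 1) m
    rw [show m + (n + 1) + 1 - m = n + 2 by omega] at hc
    have hc' : ((m + (n + 1) + 1).choose (m + 1) : ℝ) * (m + 1) =
      (m + (n + 1) + 1).choose m * (n + 2) := by exact_mod_cast hc
    have e1 : ((m + (n + 1) + 1).choose (m + 1) : ℝ) ≠ 0 :=
      Nat.cast_ne_zero.mpr (Nat.choose_pos (by omega)).ne'
    have e2 : ((m + (n + 1) + 1).choose m : ℝ) ≠ 0 :=
      Nat.cast_ne_zero.mpr (Nat.choose_pos (by omega)).ne'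
    push_cast
    field_simp
    linear_combination ((-1) ^ n * (bernoulli (m + (n + 1) + 1) : ℝ)) * hc'

theorem bernoulliFun_sq {m : ℕ} (hm : 1 ≤ m) (x : ℝ) :
    bernoulliFun m x ^ 2 =
      ∑ k ∈ Finset.range (m / 2 + 1),
        (m * m.choose (2 * k) * bernoulli (2 * k) / (m - k : ℕ) : ℝ) *
          bernoulliFun (2 * (m - k)) x +
        (-1) ^ (m - 1) * bernoulli (2 * m) / (2 * m).choose m := by
  obtain ⟨c, hc⟩ := bernoulliFun_sq_eq_add hm
  have h1 : ∫ x in (0 : ℝ)..1, bernoulliFun m x ^ 2 = c := by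
    simp_rw [hc]
    rw [intervalIntegral.integral_add (Continuous.intervalIntegrable (by fun_prop) _ _)
      (Continuous.intervalIntegrable (by fun_prop) _ _), intervalIntegral.integral_finsetSum
      fun i _ => Continuous.intervalIntegrable (by fun_prop) _ _, Finset.sum_eq_zero]
    · simp
    · intro k hk
      rw [Finset.mem_range] at hk
      rw [intervalIntegral.integral_const_mul, integral_bernoulliFun_eq_zero (by omega), mul_zero]
  have h2 := integral_bernoulliFun_mul_bernoulliFun m (m - 1) hm
  rw [show m + (m - 1) + 1 = 2 * m by omega, show m - 1 + 1 = m by omega] at h2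
  rw [hc, ← h1, ← h2]
  simp_rw [sq]

theorem sum_bernoulliFun_div (k : ℕ) {d : ℕ} (hd : d ≠ 0) :
    ∑ j ∈ Finset.range d, bernoulliFun k (j / d) = d / d ^ k * bernoulli k := by
  have h := bernoulliFun_mul k hd 0
  have hd' : (d : ℝ) ≠ 0 := Nat.cast_ne_zero.mpr hd
  simp only [mul_zero, zero_add, bernoulliFun_eval_zero] at h
  rw [h]
  field_simp

/-- The Taylor series of `f` at `x`, as a formal power series. -/
noncomputable def taylorPowerSeries (f : ℝ → ℂ) (x : ℝ) : PowerSeries ℂ :=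
  PowerSeries.mk fun n => iteratedDeriv n f x / n.factorial

theorem taylorPowerSeries_mul {f g : ℝ → ℂ} {x : ℝ} (hf : ∀ n : ℕ, ContDiffAt ℝ n f x)
    (hg : ∀ n : ℕ, ContDiffAt ℝ n g x) :
    taylorPowerSeries (f * g) x = taylorPowerSeries f x * taylorPowerSeries g x := by
  ext n
  simp only [taylorPowerSeries, PowerSeries.coeff_mul, PowerSeries.coeff_mk]
  rw [iteratedDeriv_mul (hf n) (hg n), Finset.Nat.sum_antidiagonal_eq_sum_range_succ_mk,
    Finset.sum_div]
  refine Finset.sum_congr rfl fun i hi => ?_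
  have hi' : i ≤ n := by rw [Finset.mem_range] at hi; omega
  have e : (n.choose i : ℂ) * i.factorial * (n - i).factorial = n.factorial := by
    exact_mod_cast Nat.choose_mul_factorial_mul_factorial hi'
  have e1 : (n.factorial : ℂ) ≠ 0 := Nat.cast_ne_zero.mpr n.factorial_ne_zero
  have e2 : (i.factorial : ℂ) ≠ 0 := Nat.cast_ne_zero.mpr i.factorial_ne_zero
  have e3 : ((n - i).factorial : ℂ) ≠ 0 := Nat.cast_ne_zero.mpr (n - i).factorial_ne_zero
  simp only
  field_simp
  linear_combination (iteratedDeriv i f x * iteratedDeriv (n - i) g x) * e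

theorem iteratedDeriv_add_mul_cexp (n : ℕ) (a b c : ℂ) (x : ℝ) :
    iteratedDeriv n (fun y : ℝ => a + b * Complex.exp (c * y)) x =
      (if n = 0 then a else 0) + b * c ^ n * Complex.exp (c * x) := by
  have h : ∀ y : ℝ, HasDerivAt (fun y : ℝ => Complex.exp (c * y)) (c * Complex.exp (c * y)) y := by
    intro y
    have := ((hasDerivAt_id (y : ℂ)).const_mul c).cexp.comp_ofReal
    simpa [mul_comm] using this
  induction n generalizing x with
  | zero => simp
  | succ n ih =>
    rw [iteratedDeriv_succ, funext ih, (((h x).const_mul (b * c ^ n)).const_add _).deriv]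
    simp [pow_succ, mul_assoc]

theorem taylorPowerSeries_add_mul_cexp (a b c : ℂ) (x : ℝ) :
    taylorPowerSeries (fun y : ℝ => a + b * Complex.exp (c * y)) x =
      PowerSeries.C a + PowerSeries.C (b * Complex.exp (c * x)) *
        PowerSeries.rescale c (PowerSeries.exp ℂ) := by
  ext n
  simp only [taylorPowerSeries, PowerSeries.coeff_mk, iteratedDeriv_add_mul_cexp, map_add,
    PowerSeries.coeff_C_mul, PowerSeries.coeff_rescale, PowerSeries.coeff_exp, PowerSeries.coeff_C]
  rcases n with _ | n
  · simp
  · simp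
    ring

theorem contDiffAt_cot {x : ℝ} (hx : Real.sin x ≠ 0) {n : WithTop ℕ∞} :
    ContDiffAt ℝ n Real.cot x := by
  have : Real.cot = fun y => Real.cos y / Real.sin y := funext Real.cot_eq_cos_div_sin
  rw [this]
  exact Real.contDiff_cos.contDiffAt.div Real.contDiff_sin.contDiffAt hx

theorem iteratedDeriv_ofReal_comp {f : ℝ → ℝ} {x : ℝ} {n : ℕ} (hf : ContDiffAt ℝ n f x) :
    iteratedDeriv n (fun y => (f y : ℂ)) x = ((iteratedDeriv n f x : ℝ) : ℂ) := by
  have := Complex.ofRealCLM.iteratedFDeriv_comp_left hf le_rfl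
  simp only [iteratedDeriv]
  rw [show (fun y => (f y : ℂ)) = Complex.ofRealCLM ∘ f from rfl, this]
  simp

theorem cot_mul_cexp_sub_one {x : ℝ} (hx : Real.sin x ≠ 0) :
    (Real.cot x : ℂ) * (-1 + 1 * Complex.exp (2 * Complex.I * x)) =
      Complex.I + Complex.I * Complex.exp (2 * Complex.I * x) := by
  have hs : Complex.sin x ≠ 0 := by exact_mod_cast hx
  rw [show 2 * Complex.I * x = x * Complex.I + x * Complex.I by ring, Complex.exp_add,
    Complex.exp_mul_I, Real.cot_eq_cos_div_sin]
  push_cast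
  field_simp
  linear_combination (Complex.cos x + Complex.I * Complex.sin x) *
    (Complex.sin_sq_add_cos_sq (x : ℂ) - Complex.sin x ^ 2 * Complex.I_sq)

theorem taylorPowerSeries_cot_mul {x : ℝ} (hx : Real.sin x ≠ 0) :
    taylorPowerSeries (fun y => (Real.cot y : ℂ)) x *
      (PowerSeries.C (Complex.exp (2 * Complex.I * x)) *
        PowerSeries.rescale (2 * Complex.I) (PowerSeries.exp ℂ) - 1) =
    PowerSeries.C Complex.I * (PowerSeries.C (Complex.exp (2 * Complex.I * x)) *
        PowerSeries.rescale (2 * Complex.I) (PowerSeries.exp ℂ) + 1) := by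
  have h1 := taylorPowerSeries_add_mul_cexp (-1) 1 (2 * Complex.I) x
  have h2 := taylorPowerSeries_add_mul_cexp Complex.I Complex.I (2 * Complex.I) x
  have h3 := taylorPowerSeries_mul (x := x) (f := fun y => (Real.cot y : ℂ))
    (g := fun y : ℝ => -1 + 1 * Complex.exp (2 * Complex.I * y))
    (fun n => Complex.ofRealCLM.contDiff.contDiffAt.comp x (contDiffAt_cot hx))
    (fun n => by
      have : ContDiff ℝ n (fun y : ℝ => (y : ℂ)) := Complex.ofRealCLM.contDiff
      fun_prop)
  have h4 : (fun y : ℝ => (Real.cot y : ℂ)) *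
      (fun y : ℝ => -1 + 1 * Complex.exp (2 * Complex.I * y)) =ᶠ[nhds x]
      fun y : ℝ => Complex.I + Complex.I * Complex.exp (2 * Complex.I * y) := by
    filter_upwards [Real.continuous_sin.continuousAt.eventually_ne hx] with y hy
    exact cot_mul_cexp_sub_one hy
  have h5 : taylorPowerSeries ((fun y : ℝ => (Real.cot y : ℂ)) *
      (fun y : ℝ => -1 + 1 * Complex.exp (2 * Complex.I * y))) x = taylorPowerSeries
      (fun y : ℝ => Complex.I + Complex.I * Complex.exp (2 * Complex.I * y)) x := by
    simp only [taylorPowerSeries, h4.iteratedDeriv_eq]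
  rw [h3, h1, h2] at h5
  simp only [one_mul, map_mul, map_neg, map_one] at h5
  linear_combination h5

theorem bernoulliFun_generating_function (t : ℝ) :
    (PowerSeries.mk fun n => (bernoulliFun n t : ℂ) / n.factorial) * (PowerSeries.exp ℂ - 1) =
      PowerSeries.X * PowerSeries.rescale (t : ℂ) (PowerSeries.exp ℂ) := by
  rw [← Polynomial.bernoulli_generating_function]
  congr 2
  ext n
  rw [bernoulliFun, Polynomial.eval_map_algebraMap, map_smul, Algebra.smul_def,
    show (t : ℂ) = algebraMap ℝ ℂ t from rfl, Polynomial.aeval_algebraMap_apply]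
  simp
  ring

theorem rescale_C (a w : ℂ) : PowerSeries.rescale a (PowerSeries.C w) = PowerSeries.C w := by
  ext n
  rcases n with _ | n <;> simp [PowerSeries.coeff_C]

theorem rescale_exp_pow (a : ℂ) (n : ℕ) :
    PowerSeries.rescale a (PowerSeries.exp ℂ) ^ n =
      PowerSeries.rescale (n * a) (PowerSeries.exp ℂ) := by
  rw [← map_pow, PowerSeries.exp_pow_eq_rescale_exp, PowerSeries.rescale_rescale]

theorem sum_pow_mul_bernoulliFun_generating_function {d : ℕ} (hd : d ≠ 0) {w : ℂ} (hw : w ^ d = 1) :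
    (PowerSeries.mk fun n => (∑ j ∈ Finset.range d, w ^ j * (bernoulliFun n (j / d) : ℂ)) /
      n.factorial) *
      (PowerSeries.C w * PowerSeries.rescale (1 / d : ℂ) (PowerSeries.exp ℂ) - 1) =
    PowerSeries.X := by
  have hd' : (d : ℂ) ≠ 0 := Nat.cast_ne_zero.mpr hd
  set R := PowerSeries.rescale (1 / d : ℂ) (PowerSeries.exp ℂ) with hR
  have h0 : PowerSeries.exp ℂ - 1 ≠ 0 := by
    intro h
    have := congrArg (PowerSeries.coeff 1) h
    simp [PowerSeries.coeff_one] at this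
  have h1 : (PowerSeries.mk fun n => (∑ j ∈ Finset.range d, w ^ j * (bernoulliFun n (j / d) : ℂ)) /
      n.factorial) = ∑ j ∈ Finset.range d, PowerSeries.C (w ^ j) *
      (PowerSeries.mk fun n => (bernoulliFun n (j / d : ℝ) : ℂ) / n.factorial) := by
    ext n
    simp only [map_sum, PowerSeries.coeff_mk, PowerSeries.coeff_C_mul, Finset.sum_div,
      mul_div_assoc]
  apply mul_right_cancel₀ h0
  have h2 : (∑ j ∈ Finset.range d, (PowerSeries.C w * R) ^ j) * (PowerSeries.C w * R - 1) =
      PowerSeries.exp ℂ - 1 := by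
    rw [geom_sum_mul, mul_pow, hR, rescale_exp_pow, ← map_pow, hw, mul_one_div_cancel hd']
    simp
  rw [h1, mul_right_comm, Finset.sum_mul, ← h2, ← mul_assoc, Finset.mul_sum]
  congr 1
  refine Finset.sum_congr rfl fun j _ => ?_
  rw [h2, mul_assoc, bernoulliFun_generating_function, mul_pow, hR, rescale_exp_pow]
  push_cast
  rw [map_pow, mul_one_div]
  ring

theorem iteratedDeriv_cot_eq_sum {m d : ℕ} (hm : 2 ≤ m) (hd : d ≠ 0) {x : ℝ}
    (hx : Real.sin x ≠ 0) (hw : Complex.exp (2 * Complex.I * x) ^ d = 1) :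
    ((iteratedDeriv (m - 1) Real.cot x : ℝ) : ℂ) = (2 * Complex.I) ^ m * d ^ (m - 1) / m *
      ∑ j ∈ Finset.range d, Complex.exp (2 * Complex.I * x) ^ j * (bernoulliFun m (j / d) : ℂ) := by
  have hd' : (d : ℂ) ≠ 0 := Nat.cast_ne_zero.mpr hd
  have hI : Complex.I ≠ 0 := Complex.I_ne_zero
  set w := Complex.exp (2 * Complex.I * x) with hwdef
  have hA := sum_pow_mul_bernoulliFun_generating_function hd hw
  set F := PowerSeries.mk fun n =>
    (∑ j ∈ Finset.range d, w ^ j * (bernoulliFun n (j / d) : ℂ)) / n.factorial with hF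
  have hB := taylorPowerSeries_cot_mul hx
  rw [← hwdef] at hB
  set R := PowerSeries.rescale (2 * Complex.I) (PowerSeries.exp ℂ) with hR
  set T := taylorPowerSeries (fun y => (Real.cot y : ℂ)) x with hT
  set F' := PowerSeries.rescale (2 * Complex.I * d) F with hF'
  have hA' : F' * (PowerSeries.C w * R - 1) =
      PowerSeries.C (2 * Complex.I * d) * PowerSeries.X := by
    have := congrArg (PowerSeries.rescale (2 * Complex.I * d)) hA
    rw [map_mul, map_sub, map_mul, PowerSeries.rescale_rescale, PowerSeries.rescale_X, map_one,
      rescale_C, mul_comm (1 / (d : ℂ)), mul_one_div, mul_div_cancel_right₀ _ hd'] at this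
    exact this
  have h0 : PowerSeries.C w * R - 1 ≠ 0 := by
    intro h
    rw [h, mul_zero] at hA'
    have := congrArg (PowerSeries.coeff 1) hA'
    simp [hI, hd'] at this
  have key : PowerSeries.C (2 * d : ℂ) * (T * PowerSeries.X) =
      PowerSeries.C (2 * Complex.I * d) * PowerSeries.X + 2 * F' := by
    apply mul_right_cancel₀ h0
    simp only [map_mul] at hA' ⊢
    linear_combination (PowerSeries.C 2 * PowerSeries.C (d : ℂ) * PowerSeries.X) * hB - 2 * hA'
  obtain ⟨n, rfl⟩ : ∃ n, m = n + 2 := ⟨m - 2, by omega⟩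
  have hc := congrArg (PowerSeries.coeff (n + 2)) key
  rw [PowerSeries.coeff_C_mul, PowerSeries.coeff_succ_mul_X, map_add, PowerSeries.coeff_C_mul,
    PowerSeries.coeff_X, if_neg (by omega), show (2 : PowerSeries ℂ) = PowerSeries.C 2 from
    (map_ofNat _ 2).symm, PowerSeries.coeff_C_mul, hF', PowerSeries.coeff_rescale, hF, hT,
    taylorPowerSeries, PowerSeries.coeff_mk, PowerSeries.coeff_mk,
    iteratedDeriv_ofReal_comp (contDiffAt_cot hx), Nat.factorial_succ (n + 1)] at hc
  rw [show n + 2 - 1 = n + 1 by omega]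
  have e1 : ((n + 1).factorial : ℂ) ≠ 0 := Nat.cast_ne_zero.mpr (Nat.factorial_ne_zero _)
  have e2 : ((n : ℂ) + 2) ≠ 0 := by exact_mod_cast (Nat.succ_ne_zero (n + 1))
  have e3 : ((n : ℂ) + 1 + 1) ≠ 0 := by exact_mod_cast (Nat.succ_ne_zero (n + 1))
  set Y := ∑ j ∈ Finset.range d, w ^ j * (bernoulliFun (n + 2) (j / d) : ℂ)
  push_cast at hc ⊢
  field_simp at hc ⊢
  apply mul_left_cancel₀ hd'
  linear_combination hc

theorem sum_normSq_dft (d : ℕ) (hd : d ≠ 0) (b : ℕ → ℝ) :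
    ∑ k ∈ Finset.range d, Complex.normSq (∑ j ∈ Finset.range d,
      (Complex.exp (2 * π * Complex.I / d) ^ k) ^ j * (b j : ℂ)) =
      d * ∑ j ∈ Finset.range d, b j ^ 2 := by
  set z := Complex.exp (2 * π * Complex.I / d) with hz
  have hp : IsPrimitiveRoot z d := Complex.isPrimitiveRoot_exp d hd
  have hz0 : z ≠ 0 := Complex.exp_ne_zero _
  have hconj : (starRingEnd ℂ) z = z⁻¹ := (Complex.inv_eq_conj (hp.norm'_eq_one hd)).symm
  have orth : ∀ j ∈ Finset.range d, ∀ l ∈ Finset.range d,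
      ∑ k ∈ Finset.range d, (z ^ j * (z⁻¹) ^ l) ^ k = if l = j then (d : ℂ) else 0 := by
    intro j hj l hl
    rw [Finset.mem_range] at hj hl
    split_ifs with h
    · rw [h, ← mul_pow, mul_inv_cancel₀ hz0]
      simp
    · have hne : z ^ j * (z⁻¹) ^ l ≠ 1 := by
        rw [inv_pow, ← div_eq_mul_inv, Ne, div_eq_one_iff_eq (pow_ne_zero _ hz0)]
        exact fun h' => h (hp.pow_inj hj hl h').symm
      have h1 : (z ^ j * (z⁻¹) ^ l) ^ d = 1 := by
        rw [mul_pow, pow_right_comm, pow_right_comm z⁻¹, inv_pow, hp.pow_eq_one]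
        simp
      have h2 := geom_sum_mul (z ^ j * (z⁻¹) ^ l) d
      rw [h1, sub_self] at h2
      exact (mul_eq_zero.mp h2).resolve_right (sub_ne_zero.mpr hne)
  apply Complex.ofReal_injective
  push_cast
  calc _ = ∑ k ∈ Finset.range d, ∑ j ∈ Finset.range d, ∑ l ∈ Finset.range d,
        (b j * b l : ℂ) * (z ^ j * (z⁻¹) ^ l) ^ k := by
        refine Finset.sum_congr rfl fun k _ => ?_
        rw [← Complex.mul_conj, map_sum, Finset.sum_mul_sum]
        refine Finset.sum_congr rfl fun j _ => Finset.sum_congr rfl fun l _ => ?_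
        rw [map_mul, map_pow, map_pow, hconj, Complex.conj_ofReal, mul_pow, pow_right_comm z k,
          pow_right_comm z⁻¹ k]
        ring
    _ = ∑ j ∈ Finset.range d, ∑ l ∈ Finset.range d,
        (b j * b l : ℂ) * if l = j then (d : ℂ) else 0 := by
        rw [Finset.sum_comm]
        refine Finset.sum_congr rfl fun j hj => ?_
        rw [Finset.sum_comm]
        refine Finset.sum_congr rfl fun l hl => ?_
        rw [← orth j hj l hl, Finset.mul_sum]
    _ = _ := by
        rw [Finset.mul_sum]
        refine Finset.sum_congr rfl fun j hj => ?_
        simp only [mul_ite, mul_zero, Finset.sum_ite_eq', hj, if_true]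
        ring

theorem sq_iteratedDeriv_cot_eq_normSq {m d k : ℕ} (hm : 2 ≤ m) (hk : k ∈ Finset.Ico 1 d) :
    iteratedDeriv (m - 1) Real.cot (π * k / d) ^ 2 = 4 ^ m * (d : ℝ) ^ (2 * (m - 1)) / m ^ 2 *
      Complex.normSq (∑ j ∈ Finset.range d,
        (Complex.exp (2 * π * Complex.I / d) ^ k) ^ j * (bernoulliFun m (j / d) : ℂ)) := by
  rw [Finset.mem_Ico] at hk
  have hd : d ≠ 0 := by omega
  have hd' : (0 : ℝ) < d := Nat.cast_pos.mpr (by omega)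
  have hk0 : (0 : ℝ) < k := Nat.cast_pos.mpr (by omega)
  have hkd : (k : ℝ) < d := Nat.cast_lt.mpr hk.2
  have hs : Real.sin (π * k / d) ≠ 0 := by
    refine (Real.sin_pos_of_pos_of_lt_pi (by positivity) ?_).ne'
    rw [div_lt_iff₀ hd']
    gcongr
  have hw : Complex.exp (2 * Complex.I * (π * k / d : ℝ)) =
      Complex.exp (2 * π * Complex.I / d) ^ k := by
    rw [← Complex.exp_nat_mul]
    congr 1
    push_cast
    ring
  have hw1 : (Complex.exp (2 * π * Complex.I / d) ^ k) ^ d = 1 := by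
    rw [pow_right_comm, (Complex.isPrimitiveRoot_exp d hd).pow_eq_one, one_pow]
  have h := congrArg Complex.normSq (iteratedDeriv_cot_eq_sum hm hd hs (hw ▸ hw1))
  rw [hw, Complex.normSq_ofReal, ← sq] at h
  rw [h]
  simp only [map_mul, map_div₀, map_pow, Complex.normSq_ofNat, Complex.normSq_I,
    Complex.normSq_natCast]
  ring

theorem sum_bernoulliFun_sq {m d : ℕ} (hm : 1 ≤ m) (hd : d ≠ 0) :
    (d : ℝ) ^ (2 * m) * ∑ j ∈ Finset.range d, bernoulliFun m (j / d) ^ 2 =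
      d * (∑ k ∈ Finset.range (m / 2 + 1),
        (m * m.choose (2 * k) * bernoulli (2 * k) / (m - k : ℕ) : ℝ) *
          bernoulli (2 * (m - k)) * d ^ (2 * k) +
        (-1) ^ (m - 1) * bernoulli (2 * m) / (2 * m).choose m * d ^ (2 * m)) := by
  have hd' : (d : ℝ) ≠ 0 := Nat.cast_ne_zero.mpr hd
  simp_rw [bernoulliFun_sq hm]
  rw [Finset.sum_add_distrib, Finset.sum_comm]
  simp_rw [← Finset.mul_sum, sum_bernoulliFun_div _ hd]
  rw [Finset.sum_const, Finset.card_range, nsmul_eq_mul, mul_add, mul_add, Finset.mul_sum,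
    Finset.mul_sum]
  congr 1
  · refine Finset.sum_congr rfl fun k hk => ?_
    rw [Finset.mem_range] at hk
    rw [show 2 * m = 2 * (m - k) + 2 * k by omega, pow_add]
    field_simp
  · ring

/-- **Explicit evaluation of the cotangent sums `S_m(d)`** for `m ≥ 2`, `d ≥ 2`:
`∑_{k=1}^{d-1} (cot^{(m-1)}(πk/d))²
  = 2^{2m} ((-1)^{m-1} B_{2m}/(m² C(2m,m)) d^{2m}
      + ∑_{k=0}^{⌊m/2⌋} (B_{2k} B_{2(m-k)}/(m(m-k))) C(m,2k) d^{2k}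
      - ((1+(-1)^m)/2) B_m²/m²)`. -/
theorem sum_sq_iteratedDeriv_cot (m d : ℕ) (hm : 2 ≤ m) (hd : 2 ≤ d) :
    ∑ k ∈ Finset.Ico 1 d, (iteratedDeriv (m - 1) Real.cot (π * k / d)) ^ 2
      = 2 ^ (2 * m) *
          ((-1) ^ (m - 1) * (bernoulli (2 * m) : ℝ) /
              ((m : ℝ) ^ 2 * (Nat.choose (2 * m) m : ℝ)) * (d : ℝ) ^ (2 * m)
            + (∑ k ∈ Finset.range (m / 2 + 1),
                (bernoulli (2 * k) : ℝ) * (bernoulli (2 * (m - k)) : ℝ) /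
                    ((m : ℝ) * ((m - k : ℕ) : ℝ)) *
                  (Nat.choose m (2 * k) : ℝ) * (d : ℝ) ^ (2 * k))
            - (1 + (-1) ^ m) / 2 * (bernoulli m : ℝ) ^ 2 / (m : ℝ) ^ 2) := by
  have hd0 : d ≠ 0 := by omega
  have hd' : (d : ℝ) ≠ 0 := Nat.cast_ne_zero.mpr hd0
  have hm' : (m : ℝ) ≠ 0 := Nat.cast_ne_zero.mpr (by omega)
  have parity : (1 + (-1) ^ m) / 2 * (bernoulli m : ℝ) ^ 2 = (bernoulli m : ℝ) ^ 2 := by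
    rcases Nat.even_or_odd m with h | h
    · rw [h.neg_one_pow]
      ring
    · simp [bernoulli_eq_zero_of_odd h (by omega)]
  rw [parity, Finset.sum_congr rfl fun k hk => sq_iteratedDeriv_cot_eq_normSq hm hk,
    ← Finset.mul_sum]
  have hP := sum_normSq_dft d hd0 fun j => bernoulliFun m (j / d)
  rw [Finset.range_eq_Ico, Finset.sum_eq_sum_Ico_succ_bot (by omega), ← Finset.range_eq_Ico] at hP
  simp only [pow_zero, one_pow, one_mul, zero_add] at hP
  rw [← Complex.ofReal_sum, Complex.normSq_ofReal, sum_bernoulliFun_div _ hd0] at hP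
  rw [← eq_sub_iff_add_eq'] at hP
  have hS := sum_bernoulliFun_sq (m := m) (by omega) hd0
  have hsum : ∑ k ∈ Finset.range (m / 2 + 1),
        (m * m.choose (2 * k) * bernoulli (2 * k) / (m - k : ℕ) : ℝ) *
          bernoulli (2 * (m - k)) * d ^ (2 * k) = m ^ 2 * ∑ k ∈ Finset.range (m / 2 + 1),
                (bernoulli (2 * k) : ℝ) * (bernoulli (2 * (m - k)) : ℝ) /
                    ((m : ℝ) * ((m - k : ℕ) : ℝ)) *
                  (Nat.choose m (2 * k) : ℝ) * (d : ℝ) ^ (2 * k) := by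
    rw [Finset.mul_sum]
    refine Finset.sum_congr rfl fun k hk => ?_
    have h0 : ((m - k : ℕ) : ℝ) ≠ 0 := by
      rw [Finset.mem_range] at hk
      rw [Nat.cast_ne_zero]
      omega
    field_simp
  rw [hsum] at hS
  have hpow : (d : ℝ) ^ m = d ^ (m - 1) * d := by
    rw [← pow_succ, Nat.sub_add_cancel (by omega)]
  have hc : ((2 * m).choose m : ℝ) ≠ 0 := Nat.cast_ne_zero.mpr (Nat.choose_pos (by omega)).ne'
  have he : (d : ℝ) ^ (m - 1) ≠ 0 := pow_ne_zero _ hd'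
  rw [hP, pow_mul 2 2 m, show (2 : ℝ) ^ 2 = 4 by norm_num]
  rw [pow_mul' (d : ℝ) 2 m, hpow] at hS ⊢
  rw [pow_mul' (d : ℝ) 2 (m - 1)]
  generalize (d : ℝ) ^ (m - 1) = e at *
  field_simp at hS ⊢
  linear_combination hS
end
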